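/- arXiv:2104.05498 — 2 statements merged into one kernel-verified Lean document; each statement's English description precedes it below -/
import Mathlib

section
/- Every 2-local automorphism of the algebra W₂ is an automorphism (in particular, it is linear and bijective). -/
set_option maxSynthPendingDepth 3

/-- The 2-dimensional vector space `V₂ = F²`, with standard basis `v₁ = (1,0)`, `v₂ = (0,1)`. -/
abbrev V2 (F : Type*) [Field F] := Fin 2 → F

/-- The fixed vector `v₁` (the first standard basis vector of `V₂`). -/
noncomputable def v1 (F : Type*) [Field F] : V2 F := Pi.single 0 1

/-- `W(2)`: the space of all bilinear multiplications on `V₂`. -/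
abbrev Wtwo (F : Type*) [Field F] := V2 F →ₗ[F] V2 F →ₗ[F] V2 F

variable {F : Type*} [Field F]

/-- The Kantor product on `W(2)`:
`(A·B)(x,y) = A(v₁, B(x,y)) − B(A(v₁,x), y) − B(x, A(v₁,y))`. -/
noncomputable def wmul (A B : Wtwo F) : Wtwo F :=
  LinearMap.mk₂ F
    (fun x y => A (v1 F) (B x y) - B (A (v1 F) x) y - B x (A (v1 F) y))
    (fun x x' y => by simp only [map_add, LinearMap.add_apply]; abel)
    (fun c x y => by simp only [map_smul, LinearMap.smul_apply, smul_sub])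
    (fun x y y' => by simp only [map_add, LinearMap.add_apply]; abel)
    (fun c x y => by simp only [map_smul, LinearMap.smul_apply, smul_sub])

/-- The multiplication `α^k_{i,j}` determined by `α^k_{i,j}(v_t, v_l) = δ_{it} δ_{jl} v_k`
(indices `0, 1` correspond to `1, 2` in the paper). -/
noncomputable def alph (k i j : Fin 2) : Wtwo F :=
  LinearMap.mk₂ F
    (fun x y => (x i * y j) • (Pi.single k 1 : V2 F))
    (fun x x' y => by simp [add_mul, add_smul])
    (fun c x y => by simp [smul_smul, mul_assoc])
    (fun x y y' => by simp [mul_add, add_smul])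
    (fun c x y => by simp [smul_smul]; ring_nf)

noncomputable def e1 (F : Type*) [Field F] : Wtwo F := alph 0 0 0 - alph 1 0 1 - alph 1 1 0

noncomputable def e2 (F : Type*) [Field F] : Wtwo F := alph 1 0 0

noncomputable def e3 (F : Type*) [Field F] : Wtwo F := alph 1 1 1 - alph 0 0 1 - alph 0 1 0

noncomputable def e4 (F : Type*) [Field F] : Wtwo F := alph 0 1 1

noncomputable def e5 (F : Type*) [Field F] : Wtwo F := (2 : F) • alph 0 0 0 + alph 1 0 1 + alph 1 1 0

noncomputable def e6 (F : Type*) [Field F] : Wtwo F := (2 : F) • alph 1 1 1 + alph 0 0 1 + alph 0 1 0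


theorem wmul_add_left (A A' B : Wtwo F) : wmul (A + A') B = wmul A B + wmul A' B := by
  apply LinearMap.ext; intro x; apply LinearMap.ext; intro y
  simp [wmul]; abel

theorem wmul_smul_left (c : F) (A B : Wtwo F) : wmul (c • A) B = c • wmul A B := by
  apply LinearMap.ext; intro x; apply LinearMap.ext; intro y
  simp [wmul, smul_sub]

theorem wmul_add_right (A B B' : Wtwo F) : wmul A (B + B') = wmul A B + wmul A B' := by
  apply LinearMap.ext; intro x; apply LinearMap.ext; intro y
  simp [wmul]; abel

theorem wmul_smul_right (c : F) (A B : Wtwo F) : wmul A (c • B) = c • wmul A B := by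
  apply LinearMap.ext; intro x; apply LinearMap.ext; intro y
  simp [wmul, smul_sub]

theorem wmul_sub_left (A A' B : Wtwo F) : wmul (A - A') B = wmul A B - wmul A' B := by
  apply LinearMap.ext; intro x; apply LinearMap.ext; intro y
  simp [wmul]; abel

theorem wmul_sub_right (A B B' : Wtwo F) : wmul A (B - B') = wmul A B - wmul A B' := by
  apply LinearMap.ext; intro x; apply LinearMap.ext; intro y
  simp [wmul]; abel

theorem wmul_alph (k i j k' i' j' : Fin 2) :
    wmul (alph k i j) (alph k' i' j' : Wtwo F) =
      (if i = 0 then (1:F) else 0) •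
        ((if j = k' then (1:F) else 0) • alph k i' j'
          - (if k = i' then (1:F) else 0) • alph k' j j'
          - (if k = j' then (1:F) else 0) • alph k' i' j) := by
  apply LinearMap.ext; intro x; apply LinearMap.ext; intro y
  funext m
  simp [wmul, alph, v1, Pi.single_apply]
  split_ifs <;> simp_all <;> try ring

theorem mul_e4_left (B : Wtwo F) : wmul (e4 F) B = 0 := by
  apply LinearMap.ext; intro x; apply LinearMap.ext; intro y
  simp [wmul, e4, alph, v1, Pi.single_apply]

theorem wmul_left_eq (A A' B : Wtwo F) (h : A (v1 F) = A' (v1 F)) : wmul A B = wmul A' B := by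
  apply LinearMap.ext; intro x; apply LinearMap.ext; intro y
  simp [wmul, h]

theorem red_e1 (B : Wtwo F) :
    wmul (e1 F) B = wmul (alph 0 0 0) B - wmul (alph 1 0 1) B := by
  rw [wmul_left_eq (e1 F) (alph 0 0 0 - alph 1 0 1) B, wmul_sub_left]
  apply LinearMap.ext; intro z; funext m
  fin_cases m <;> simp [e1, alph, v1, Pi.single_apply]

theorem red_e3 (B : Wtwo F) : wmul (e3 F) B = -wmul (alph 0 0 1) B := by
  have h : wmul (e3 F) B = wmul ((-1 : F) • alph 0 0 1) B := by
    apply wmul_left_eq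
    apply LinearMap.ext; intro z; funext m
    fin_cases m <;> simp [e3, alph, v1, Pi.single_apply]
  rw [h, wmul_smul_left]; module

theorem red_e5 (B : Wtwo F) :
    wmul (e5 F) B = (2 : F) • wmul (alph 0 0 0) B + wmul (alph 1 0 1) B := by
  rw [wmul_left_eq (e5 F) ((2 : F) • alph 0 0 0 + alph 1 0 1) B, wmul_add_left, wmul_smul_left]
  apply LinearMap.ext; intro z; funext m
  fin_cases m <;> simp [e5, alph, v1, Pi.single_apply]

theorem red_e6 (B : Wtwo F) : wmul (e6 F) B = wmul (alph 0 0 1) B := by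
  apply wmul_left_eq
  apply LinearMap.ext; intro z; funext m
  fin_cases m <;> simp [e6, alph, v1, Pi.single_apply]

theorem mul_L00_e1 : wmul (alph 0 0 0) (e1 F) = ((-1 : F)) • e1 F := by
  simp only [e1, e2, e3, e4, e5, e6, wmul_sub_right, wmul_add_right, wmul_smul_right, wmul_alph,
    Fin.reduceEq, reduceIte, one_smul, zero_smul, smul_zero, sub_zero, zero_sub,
    smul_sub, smul_add, smul_smul, neg_neg, smul_neg, neg_zero, sub_self, add_zero, zero_add]
  try module

theorem mul_L00_e2 : wmul (alph 0 0 0) (e2 F) = ((-2 : F)) • e2 F := by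
  simp only [e1, e2, e3, e4, e5, e6, wmul_sub_right, wmul_add_right, wmul_smul_right, wmul_alph,
    Fin.reduceEq, reduceIte, one_smul, zero_smul, smul_zero, sub_zero, zero_sub,
    smul_sub, smul_add, smul_smul, neg_neg, smul_neg, neg_zero, sub_self, add_zero, zero_add]
  try module

theorem mul_L00_e3 : wmul (alph 0 0 0) (e3 F) = 0 := by
  simp only [e1, e2, e3, e4, e5, e6, wmul_sub_right, wmul_add_right, wmul_smul_right, wmul_alph,
    Fin.reduceEq, reduceIte, one_smul, zero_smul, smul_zero, sub_zero, zero_sub,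
    smul_sub, smul_add, smul_smul, neg_neg, smul_neg, neg_zero, sub_self, add_zero, zero_add]
  try module

theorem mul_L00_e4 : wmul (alph 0 0 0) (e4 F) = ((1 : F)) • e4 F := by
  simp only [e1, e2, e3, e4, e5, e6, wmul_sub_right, wmul_add_right, wmul_smul_right, wmul_alph,
    Fin.reduceEq, reduceIte, one_smul, zero_smul, smul_zero, sub_zero, zero_sub,
    smul_sub, smul_add, smul_smul, neg_neg, smul_neg, neg_zero, sub_self, add_zero, zero_add]
  try module

theorem mul_L00_e5 : wmul (alph 0 0 0) (e5 F) = ((-1 : F)) • e5 F := by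
  simp only [e1, e2, e3, e4, e5, e6, wmul_sub_right, wmul_add_right, wmul_smul_right, wmul_alph,
    Fin.reduceEq, reduceIte, one_smul, zero_smul, smul_zero, sub_zero, zero_sub,
    smul_sub, smul_add, smul_smul, neg_neg, smul_neg, neg_zero, sub_self, add_zero, zero_add]
  try module

theorem mul_L00_e6 : wmul (alph 0 0 0) (e6 F) = 0 := by
  simp only [e1, e2, e3, e4, e5, e6, wmul_sub_right, wmul_add_right, wmul_smul_right, wmul_alph,
    Fin.reduceEq, reduceIte, one_smul, zero_smul, smul_zero, sub_zero, zero_sub,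
    smul_sub, smul_add, smul_smul, neg_neg, smul_neg, neg_zero, sub_self, add_zero, zero_add]
  try module

theorem mul_L01_e1 : wmul (alph 0 0 1) (e1 F) = ((2 : F)) • e3 F := by
  simp only [e1, e2, e3, e4, e5, e6, wmul_sub_right, wmul_add_right, wmul_smul_right, wmul_alph,
    Fin.reduceEq, reduceIte, one_smul, zero_smul, smul_zero, sub_zero, zero_sub,
    smul_sub, smul_add, smul_smul, neg_neg, smul_neg, neg_zero, sub_self, add_zero, zero_add]
  try module

theorem mul_L01_e2 : wmul (alph 0 0 1) (e2 F) = ((1 : F)) • e1 F := by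
  simp only [e1, e2, e3, e4, e5, e6, wmul_sub_right, wmul_add_right, wmul_smul_right, wmul_alph,
    Fin.reduceEq, reduceIte, one_smul, zero_smul, smul_zero, sub_zero, zero_sub,
    smul_sub, smul_add, smul_smul, neg_neg, smul_neg, neg_zero, sub_self, add_zero, zero_add]
  try module

theorem mul_L01_e3 : wmul (alph 0 0 1) (e3 F) = ((3 : F)) • e4 F := by
  simp only [e1, e2, e3, e4, e5, e6, wmul_sub_right, wmul_add_right, wmul_smul_right, wmul_alph,
    Fin.reduceEq, reduceIte, one_smul, zero_smul, smul_zero, sub_zero, zero_sub,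
    smul_sub, smul_add, smul_smul, neg_neg, smul_neg, neg_zero, sub_self, add_zero, zero_add]
  try module

theorem mul_L01_e4 : wmul (alph 0 0 1) (e4 F) = 0 := by
  simp only [e1, e2, e3, e4, e5, e6, wmul_sub_right, wmul_add_right, wmul_smul_right, wmul_alph,
    Fin.reduceEq, reduceIte, one_smul, zero_smul, smul_zero, sub_zero, zero_sub,
    smul_sub, smul_add, smul_smul, neg_neg, smul_neg, neg_zero, sub_self, add_zero, zero_add]
  try module

theorem mul_L01_e5 : wmul (alph 0 0 1) (e5 F) = ((-1 : F)) • e6 F := by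
  simp only [e1, e2, e3, e4, e5, e6, wmul_sub_right, wmul_add_right, wmul_smul_right, wmul_alph,
    Fin.reduceEq, reduceIte, one_smul, zero_smul, smul_zero, sub_zero, zero_sub,
    smul_sub, smul_add, smul_smul, neg_neg, smul_neg, neg_zero, sub_self, add_zero, zero_add]
  try module

theorem mul_L01_e6 : wmul (alph 0 0 1) (e6 F) = 0 := by
  simp only [e1, e2, e3, e4, e5, e6, wmul_sub_right, wmul_add_right, wmul_smul_right, wmul_alph,
    Fin.reduceEq, reduceIte, one_smul, zero_smul, smul_zero, sub_zero, zero_sub,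
    smul_sub, smul_add, smul_smul, neg_neg, smul_neg, neg_zero, sub_self, add_zero, zero_add]
  try module

theorem mul_L10_e1 : wmul (e2 F) (e1 F) = ((3 : F)) • e2 F := by
  simp only [e1, e2, e3, e4, e5, e6, wmul_sub_right, wmul_add_right, wmul_smul_right, wmul_alph,
    Fin.reduceEq, reduceIte, one_smul, zero_smul, smul_zero, sub_zero, zero_sub,
    smul_sub, smul_add, smul_smul, neg_neg, smul_neg, neg_zero, sub_self, add_zero, zero_add]
  try module

theorem mul_L10_e2 : wmul (e2 F) (e2 F) = 0 := by
  simp only [e1, e2, e3, e4, e5, e6, wmul_sub_right, wmul_add_right, wmul_smul_right, wmul_alph,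
    Fin.reduceEq, reduceIte, one_smul, zero_smul, smul_zero, sub_zero, zero_sub,
    smul_sub, smul_add, smul_smul, neg_neg, smul_neg, neg_zero, sub_self, add_zero, zero_add]
  try module

theorem mul_L10_e3 : wmul (e2 F) (e3 F) = ((2 : F)) • e1 F := by
  simp only [e1, e2, e3, e4, e5, e6, wmul_sub_right, wmul_add_right, wmul_smul_right, wmul_alph,
    Fin.reduceEq, reduceIte, one_smul, zero_smul, smul_zero, sub_zero, zero_sub,
    smul_sub, smul_add, smul_smul, neg_neg, smul_neg, neg_zero, sub_self, add_zero, zero_add]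
  try module

theorem mul_L10_e4 : wmul (e2 F) (e4 F) = ((1 : F)) • e3 F := by
  simp only [e1, e2, e3, e4, e5, e6, wmul_sub_right, wmul_add_right, wmul_smul_right, wmul_alph,
    Fin.reduceEq, reduceIte, one_smul, zero_smul, smul_zero, sub_zero, zero_sub,
    smul_sub, smul_add, smul_smul, neg_neg, smul_neg, neg_zero, sub_self, add_zero, zero_add]
  try module

theorem mul_L10_e5 : wmul (e2 F) (e5 F) = 0 := by
  simp only [e1, e2, e3, e4, e5, e6, wmul_sub_right, wmul_add_right, wmul_smul_right, wmul_alph,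
    Fin.reduceEq, reduceIte, one_smul, zero_smul, smul_zero, sub_zero, zero_sub,
    smul_sub, smul_add, smul_smul, neg_neg, smul_neg, neg_zero, sub_self, add_zero, zero_add]
  try module

theorem mul_L10_e6 : wmul (e2 F) (e6 F) = ((-1 : F)) • e5 F := by
  simp only [e1, e2, e3, e4, e5, e6, wmul_sub_right, wmul_add_right, wmul_smul_right, wmul_alph,
    Fin.reduceEq, reduceIte, one_smul, zero_smul, smul_zero, sub_zero, zero_sub,
    smul_sub, smul_add, smul_smul, neg_neg, smul_neg, neg_zero, sub_self, add_zero, zero_add]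
  try module

theorem mul_L11_e1 : wmul (alph 1 0 1) (e1 F) = 0 := by
  simp only [e1, e2, e3, e4, e5, e6, wmul_sub_right, wmul_add_right, wmul_smul_right, wmul_alph,
    Fin.reduceEq, reduceIte, one_smul, zero_smul, smul_zero, sub_zero, zero_sub,
    smul_sub, smul_add, smul_smul, neg_neg, smul_neg, neg_zero, sub_self, add_zero, zero_add]
  try module

theorem mul_L11_e2 : wmul (alph 1 0 1) (e2 F) = ((1 : F)) • e2 F := by
  simp only [e1, e2, e3, e4, e5, e6, wmul_sub_right, wmul_add_right, wmul_smul_right, wmul_alph,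
    Fin.reduceEq, reduceIte, one_smul, zero_smul, smul_zero, sub_zero, zero_sub,
    smul_sub, smul_add, smul_smul, neg_neg, smul_neg, neg_zero, sub_self, add_zero, zero_add]
  try module

theorem mul_L11_e3 : wmul (alph 1 0 1) (e3 F) = ((-1 : F)) • e3 F := by
  simp only [e1, e2, e3, e4, e5, e6, wmul_sub_right, wmul_add_right, wmul_smul_right, wmul_alph,
    Fin.reduceEq, reduceIte, one_smul, zero_smul, smul_zero, sub_zero, zero_sub,
    smul_sub, smul_add, smul_smul, neg_neg, smul_neg, neg_zero, sub_self, add_zero, zero_add]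
  try module

theorem mul_L11_e4 : wmul (alph 1 0 1) (e4 F) = ((-2 : F)) • e4 F := by
  simp only [e1, e2, e3, e4, e5, e6, wmul_sub_right, wmul_add_right, wmul_smul_right, wmul_alph,
    Fin.reduceEq, reduceIte, one_smul, zero_smul, smul_zero, sub_zero, zero_sub,
    smul_sub, smul_add, smul_smul, neg_neg, smul_neg, neg_zero, sub_self, add_zero, zero_add]
  try module

theorem mul_L11_e5 : wmul (alph 1 0 1) (e5 F) = 0 := by
  simp only [e1, e2, e3, e4, e5, e6, wmul_sub_right, wmul_add_right, wmul_smul_right, wmul_alph,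
    Fin.reduceEq, reduceIte, one_smul, zero_smul, smul_zero, sub_zero, zero_sub,
    smul_sub, smul_add, smul_smul, neg_neg, smul_neg, neg_zero, sub_self, add_zero, zero_add]
  try module

theorem mul_L11_e6 : wmul (alph 1 0 1) (e6 F) = ((-1 : F)) • e6 F := by
  simp only [e1, e2, e3, e4, e5, e6, wmul_sub_right, wmul_add_right, wmul_smul_right, wmul_alph,
    Fin.reduceEq, reduceIte, one_smul, zero_smul, smul_zero, sub_zero, zero_sub,
    smul_sub, smul_add, smul_smul, neg_neg, smul_neg, neg_zero, sub_self, add_zero, zero_add]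
  try module

/-- `W2` as a subspace of `W(2)`. -/
noncomputable def W2 (F : Type*) [Field F] : Submodule F (Wtwo F) :=
  Submodule.span F {e1 F, e2 F, e3 F, e4 F, e5 F, e6 F}

/-- The Kantor product, as a bilinear map. -/
noncomputable def wmulL (F : Type*) [Field F] : Wtwo F →ₗ[F] Wtwo F →ₗ[F] Wtwo F :=
  LinearMap.mk₂ F wmul wmul_add_left wmul_smul_left wmul_add_right wmul_smul_right

set_option maxHeartbeats 2000000 in
theorem W2_mul_mem {x y : Wtwo F} (hx : x ∈ W2 F) (hy : y ∈ W2 F) :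
    wmul x y ∈ W2 F := by
  have h2 : Submodule.map₂ (wmulL F) (W2 F) (W2 F) ≤ W2 F := by
    rw [W2, Submodule.map₂_span_span, Submodule.span_le]
    rintro z ⟨a, ha, b, hb, rfl⟩
    simp only [Set.mem_insert_iff, Set.mem_singleton_iff] at ha hb
    have m1 : e1 F ∈ W2 F := Submodule.subset_span (by simp)
    have m2 : e2 F ∈ W2 F := Submodule.subset_span (by simp)
    have m3 : e3 F ∈ W2 F := Submodule.subset_span (by simp)
    have m4 : e4 F ∈ W2 F := Submodule.subset_span (by simp)
    have m5 : e5 F ∈ W2 F := Submodule.subset_span (by simp)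
    have m6 : e6 F ∈ W2 F := Submodule.subset_span (by simp)
    rcases ha with rfl | rfl | rfl | rfl | rfl | rfl <;> rcases hb with rfl | rfl | rfl | rfl | rfl | rfl <;>
      simp only [wmulL, LinearMap.mk₂_apply, red_e1, red_e3, red_e5, red_e6, mul_L00_e1, mul_L00_e2, mul_L00_e3, mul_L00_e4, mul_L00_e5, mul_L00_e6, mul_L01_e1, mul_L01_e2, mul_L01_e3, mul_L01_e4, mul_L01_e5, mul_L01_e6, mul_L10_e1, mul_L10_e2, mul_L10_e3, mul_L10_e4, mul_L10_e5, mul_L10_e6, mul_L11_e1, mul_L11_e2, mul_L11_e3, mul_L11_e4, mul_L11_e5, mul_L11_e6, mul_e4_left,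
        smul_smul, smul_zero, neg_zero, sub_zero, zero_sub, zero_add, add_zero, smul_neg,
        neg_neg, sub_self] <;>
      (repeat' first
        | exact Submodule.zero_mem _
        | exact m1 | exact m2 | exact m3 | exact m4 | exact m5 | exact m6
        | apply Submodule.neg_mem
        | apply Submodule.sub_mem
        | apply Submodule.add_mem
        | apply Submodule.smul_mem)
  exact h2 (Submodule.apply_mem_map₂ _ hx hy)

/-- The product on `W2` (the Kantor product, which leaves `W2` invariant). -/
noncomputable def W2mul (x y : W2 F) : W2 F :=
  ⟨wmul x y, W2_mul_mem x.2 y.2⟩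

/-- An automorphism of the algebra `W2`. -/
def IsAutomorphismW2 (φ : W2 F →ₗ[F] W2 F) : Prop :=
  Function.Bijective φ ∧ ∀ x y : W2 F, φ (W2mul x y) = W2mul (φ x) (φ y)

/-- In characteristic zero, a subspace of `W(2)` which is closed under the Kantor product and
contains `e₂ + e₆` contains all of `W₂`: the algebra `W₂` is generated by `e₂ + e₆`. -/
theorem W2_le_of_e2_add_e6_mem [CharZero F] (T : Submodule F (Wtwo F))
    (hmul : ∀ a ∈ T, ∀ b ∈ T, wmul a b ∈ T) (hz : e2 F + e6 F ∈ T) : W2 F ≤ T := by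
  have hw : e1 F - e5 F ∈ T := by
    convert hmul _ hz _ hz using 1
    simp only [wmul_add_left, wmul_add_right, red_e6, mul_L10_e2, mul_L10_e6, mul_L01_e2,
      mul_L01_e6]
    module
  have h6 : e6 F ∈ T := by
    refine (T.smul_mem_iff (two_ne_zero (α := F))).1 ?_
    convert hmul _ hw _ hz using 1
    simp only [wmul_sub_left, wmul_add_right, red_e1, red_e5, mul_L00_e2, mul_L00_e6, mul_L11_e2,
      mul_L11_e6]
    module
  have h2 : e2 F ∈ T := by simpa using T.sub_mem hz h6
  have h5 : e5 F ∈ T := by simpa [mul_L10_e6] using hmul _ h2 _ h6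
  have h1 : e1 F ∈ T := by simpa using T.add_mem hw h5
  have h3 : e3 F ∈ T := by
    refine (T.smul_mem_iff (two_ne_zero (α := F))).1 ?_
    simpa only [red_e6, mul_L01_e1] using hmul _ h6 _ h1
  have h4 : e4 F ∈ T := by
    refine (T.smul_mem_iff (three_ne_zero (α := F))).1 ?_
    simpa only [red_e6, mul_L01_e3] using hmul _ h6 _ h3
  rw [W2, Submodule.span_le]
  rintro x (rfl | rfl | rfl | rfl | rfl | rfl) <;> assumption

/-- The generator `e₂ + e₆` of the algebra `W₂`. -/
noncomputable def W2generator (F : Type*) [Field F] : W2 F :=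
  ⟨e2 F + e6 F, add_mem (Submodule.subset_span (by simp)) (Submodule.subset_span (by simp))⟩

/-- An automorphism of `W₂` is determined by its value at the generator. -/
theorem IsAutomorphismW2.ext_of_generator [CharZero F] {φ ψ : W2 F →ₗ[F] W2 F}
    (hφ : IsAutomorphismW2 φ) (hψ : IsAutomorphismW2 ψ)
    (h : φ (W2generator F) = ψ (W2generator F)) : φ = ψ := by
  have hle : W2 F ≤ (LinearMap.eqLocus φ ψ).map (W2 F).subtype := by
    apply W2_le_of_e2_add_e6_mem
    · rintro _ ⟨a, ha, rfl⟩ _ ⟨b, hb, rfl⟩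
      rw [SetLike.mem_coe, LinearMap.mem_eqLocus] at ha hb
      refine ⟨W2mul a b, ?_, rfl⟩
      rw [SetLike.mem_coe, LinearMap.mem_eqLocus, hφ.2, hψ.2, ha, hb]
    · exact ⟨W2generator F, h, rfl⟩
  ext1 x
  obtain ⟨y, hy, hyx⟩ := hle x.2
  rwa [Subtype.ext hyx] at hy

/-- Every 2-local automorphism of the algebra `W2` is an automorphism
(in particular, it is linear and bijective). -/
theorem every_twoLocalAutomorphism_isAutomorphism_W2 {F : Type*} [Field F] [CharZero F]
    (Δ : W2 F → W2 F)
    (hΔ : ∀ x y : W2 F, ∃ φ : W2 F →ₗ[F] W2 F,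
      IsAutomorphismW2 φ ∧ Δ x = φ x ∧ Δ y = φ y) :
    ∃ φ : W2 F →ₗ[F] W2 F, IsAutomorphismW2 φ ∧ ∀ z : W2 F, Δ z = φ z := by
  obtain ⟨φ, hφ, hφz, -⟩ := hΔ (W2generator F) (W2generator F)
  refine ⟨φ, hφ, fun x => ?_⟩
  obtain ⟨ψ, hψ, hψz, hψx⟩ := hΔ (W2generator F) x
  rw [hψx, hφ.ext_of_generator hψ (hφz.symm.trans hψz)]
end

section
/- Every local automorphism of the algebra S₂ is an automorphism. -/
set_option maxSynthPendingDepth 3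

variable {F : Type*} [Field F]

theorem mul_e1_e1 : wmul (e1 F) (e1 F) = ((-1 : F)) • e1 F := by
  simp only [e1, e2, e3, e4, wmul_sub_left, wmul_sub_right, wmul_add_left, wmul_add_right,
    wmul_smul_left, wmul_smul_right, wmul_alph, Fin.reduceEq, reduceIte, one_smul, zero_smul,
    smul_zero, sub_zero, zero_sub, smul_sub, smul_add, smul_smul, neg_neg, smul_neg, neg_zero,
    sub_self, add_zero, zero_add]
  try module

theorem mul_e1_e2 : wmul (e1 F) (e2 F) = ((-3 : F)) • e2 F := by
  simp only [e1, e2, e3, e4, wmul_sub_left, wmul_sub_right, wmul_add_left, wmul_add_right,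
    wmul_smul_left, wmul_smul_right, wmul_alph, Fin.reduceEq, reduceIte, one_smul, zero_smul,
    smul_zero, sub_zero, zero_sub, smul_sub, smul_add, smul_smul, neg_neg, smul_neg, neg_zero,
    sub_self, add_zero, zero_add]
  try module

theorem mul_e1_e3 : wmul (e1 F) (e3 F) = ((1 : F)) • e3 F := by
  simp only [e1, e2, e3, e4, wmul_sub_left, wmul_sub_right, wmul_add_left, wmul_add_right,
    wmul_smul_left, wmul_smul_right, wmul_alph, Fin.reduceEq, reduceIte, one_smul, zero_smul,
    smul_zero, sub_zero, zero_sub, smul_sub, smul_add, smul_smul, neg_neg, smul_neg, neg_zero,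
    sub_self, add_zero, zero_add]
  try module

theorem mul_e1_e4 : wmul (e1 F) (e4 F) = ((3 : F)) • e4 F := by
  simp only [e1, e2, e3, e4, wmul_sub_left, wmul_sub_right, wmul_add_left, wmul_add_right,
    wmul_smul_left, wmul_smul_right, wmul_alph, Fin.reduceEq, reduceIte, one_smul, zero_smul,
    smul_zero, sub_zero, zero_sub, smul_sub, smul_add, smul_smul, neg_neg, smul_neg, neg_zero,
    sub_self, add_zero, zero_add]
  try module

theorem mul_e2_e1 : wmul (e2 F) (e1 F) = ((3 : F)) • e2 F := by
  simp only [e1, e2, e3, e4, wmul_sub_left, wmul_sub_right, wmul_add_left, wmul_add_right,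
    wmul_smul_left, wmul_smul_right, wmul_alph, Fin.reduceEq, reduceIte, one_smul, zero_smul,
    smul_zero, sub_zero, zero_sub, smul_sub, smul_add, smul_smul, neg_neg, smul_neg, neg_zero,
    sub_self, add_zero, zero_add]
  try module

theorem mul_e2_e2 : wmul (e2 F) (e2 F) = 0 := by
  simp only [e1, e2, e3, e4, wmul_sub_left, wmul_sub_right, wmul_add_left, wmul_add_right,
    wmul_smul_left, wmul_smul_right, wmul_alph, Fin.reduceEq, reduceIte, one_smul, zero_smul,
    smul_zero, sub_zero, zero_sub, smul_sub, smul_add, smul_smul, neg_neg, smul_neg, neg_zero,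
    sub_self, add_zero, zero_add]
  try module

theorem mul_e2_e3 : wmul (e2 F) (e3 F) = ((2 : F)) • e1 F := by
  simp only [e1, e2, e3, e4, wmul_sub_left, wmul_sub_right, wmul_add_left, wmul_add_right,
    wmul_smul_left, wmul_smul_right, wmul_alph, Fin.reduceEq, reduceIte, one_smul, zero_smul,
    smul_zero, sub_zero, zero_sub, smul_sub, smul_add, smul_smul, neg_neg, smul_neg, neg_zero,
    sub_self, add_zero, zero_add]
  try module

theorem mul_e2_e4 : wmul (e2 F) (e4 F) = ((1 : F)) • e3 F := by
  simp only [e1, e2, e3, e4, wmul_sub_left, wmul_sub_right, wmul_add_left, wmul_add_right,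
    wmul_smul_left, wmul_smul_right, wmul_alph, Fin.reduceEq, reduceIte, one_smul, zero_smul,
    smul_zero, sub_zero, zero_sub, smul_sub, smul_add, smul_smul, neg_neg, smul_neg, neg_zero,
    sub_self, add_zero, zero_add]
  try module

theorem mul_e3_e1 : wmul (e3 F) (e1 F) = ((-2 : F)) • e3 F := by
  simp only [e1, e2, e3, e4, wmul_sub_left, wmul_sub_right, wmul_add_left, wmul_add_right,
    wmul_smul_left, wmul_smul_right, wmul_alph, Fin.reduceEq, reduceIte, one_smul, zero_smul,
    smul_zero, sub_zero, zero_sub, smul_sub, smul_add, smul_smul, neg_neg, smul_neg, neg_zero,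
    sub_self, add_zero, zero_add]
  try module

theorem mul_e3_e2 : wmul (e3 F) (e2 F) = ((-1 : F)) • e1 F := by
  simp only [e1, e2, e3, e4, wmul_sub_left, wmul_sub_right, wmul_add_left, wmul_add_right,
    wmul_smul_left, wmul_smul_right, wmul_alph, Fin.reduceEq, reduceIte, one_smul, zero_smul,
    smul_zero, sub_zero, zero_sub, smul_sub, smul_add, smul_smul, neg_neg, smul_neg, neg_zero,
    sub_self, add_zero, zero_add]
  try module

theorem mul_e3_e3 : wmul (e3 F) (e3 F) = ((-3 : F)) • e4 F := by
  simp only [e1, e2, e3, e4, wmul_sub_left, wmul_sub_right, wmul_add_left, wmul_add_right,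
    wmul_smul_left, wmul_smul_right, wmul_alph, Fin.reduceEq, reduceIte, one_smul, zero_smul,
    smul_zero, sub_zero, zero_sub, smul_sub, smul_add, smul_smul, neg_neg, smul_neg, neg_zero,
    sub_self, add_zero, zero_add]
  try module

theorem mul_e3_e4 : wmul (e3 F) (e4 F) = 0 := by
  simp only [e1, e2, e3, e4, wmul_sub_left, wmul_sub_right, wmul_add_left, wmul_add_right,
    wmul_smul_left, wmul_smul_right, wmul_alph, Fin.reduceEq, reduceIte, one_smul, zero_smul,
    smul_zero, sub_zero, zero_sub, smul_sub, smul_add, smul_smul, neg_neg, smul_neg, neg_zero,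
    sub_self, add_zero, zero_add]
  try module

/-- `S2` as a subspace of `W(2)`. -/
noncomputable def S2 (F : Type*) [Field F] : Submodule F (Wtwo F) :=
  Submodule.span F {e1 F, e2 F, e3 F, e4 F}

theorem S2_mul_mem {x y : Wtwo F} (hx : x ∈ S2 F) (hy : y ∈ S2 F) :
    wmul x y ∈ S2 F := by
  have h2 : Submodule.map₂ (wmulL F) (S2 F) (S2 F) ≤ S2 F := by
    rw [S2, Submodule.map₂_span_span, Submodule.span_le]
    rintro z ⟨a, ha, b, hb, rfl⟩
    simp only [Set.mem_insert_iff, Set.mem_singleton_iff] at ha hb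
    rcases ha with rfl | rfl | rfl | rfl <;> rcases hb with rfl | rfl | rfl | rfl <;>
      simp only [wmulL, LinearMap.mk₂_apply, mul_e1_e1, mul_e1_e2, mul_e1_e3, mul_e1_e4, mul_e2_e1, mul_e2_e2, mul_e2_e3, mul_e2_e4, mul_e3_e1, mul_e3_e2, mul_e3_e3, mul_e3_e4, mul_e4_left] <;>
      first
        | exact Submodule.zero_mem _
        | exact Submodule.smul_mem _ _ (Submodule.subset_span (by simp))
        | exact Submodule.subset_span (by simp)
  exact h2 (Submodule.apply_mem_map₂ _ hx hy)

/-- The product on `S2` (the Kantor product, which leaves `S2` invariant). -/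
noncomputable def S2mul (x y : S2 F) : S2 F :=
  ⟨wmul x y, S2_mul_mem x.2 y.2⟩

/-- An automorphism of the algebra `S2`. -/
def IsAutomorphismS2 (φ : S2 F →ₗ[F] S2 F) : Prop :=
  Function.Bijective φ ∧ ∀ x y : S2 F, φ (S2mul x y) = S2mul (φ x) (φ y)

/-- The element of `S2` with coordinates `(a, b, c, d)` in the basis `e1, e2, e3, e4`. -/
noncomputable def S2.ofCoords (a b c d : F) : S2 F :=
  ⟨a • e1 F + b • e2 F + c • e3 F + d • e4 F, by
    refine add_mem (add_mem (add_mem ?_ ?_) ?_) ?_ <;>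
      exact Submodule.smul_mem _ _ (Submodule.subset_span (by simp))⟩

theorem S2.coe_ofCoords (a b c d : F) :
    (S2.ofCoords a b c d : Wtwo F) = a • e1 F + b • e2 F + c • e3 F + d • e4 F := rfl

theorem S2.exists_eq_ofCoords (x : S2 F) : ∃ a b c d, x = S2.ofCoords a b c d := by
  obtain ⟨x, hx⟩ := x
  have hx' := hx
  simp only [S2, Submodule.mem_span_insert, Submodule.mem_span_singleton] at hx'
  obtain ⟨a, _, ⟨b, _, ⟨c, _, ⟨d, rfl⟩, rfl⟩, rfl⟩, rfl⟩ := hx'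
  exact ⟨a, b, c, d, Subtype.ext (by simp only [S2.coe_ofCoords]; abel)⟩

theorem S2.ofCoords_inj {a b c d a' b' c' d' : F} :
    S2.ofCoords a b c d = S2.ofCoords a' b' c' d' ↔ a = a' ∧ b = b' ∧ c = c' ∧ d = d' := by
  refine ⟨fun h => ?_, by rintro ⟨rfl, rfl, rfl, rfl⟩; rfl⟩
  have key (i m : Fin 2) := congrArg (fun x : S2 F =>
    (x : Wtwo F) (Pi.single i 1) (Pi.single i 1) m) h
  have h00 := key 0 0
  have h01 := key 0 1
  have h11 := key 1 1
  have h10 := key 1 0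
  simp [S2.coe_ofCoords, e1, e2, e3, e4, alph] at h00 h01 h11 h10
  exact ⟨h00, h01, h11, h10⟩

theorem S2.ofCoords_add (a b c d a' b' c' d' : F) :
    S2.ofCoords a b c d + S2.ofCoords a' b' c' d' =
      S2.ofCoords (a + a') (b + b') (c + c') (d + d') :=
  Subtype.ext (by simp only [Submodule.coe_add, S2.coe_ofCoords]; module)

theorem S2.smul_ofCoords (r a b c d : F) :
    r • S2.ofCoords a b c d = S2.ofCoords (r * a) (r * b) (r * c) (r * d) :=
  Subtype.ext (by simp only [Submodule.coe_smul, S2.coe_ofCoords]; module)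

theorem S2.ofCoords_eq_sum (a b c d : F) :
    S2.ofCoords a b c d = a • S2.ofCoords 1 0 0 0 + b • S2.ofCoords 0 1 0 0 +
      c • S2.ofCoords 0 0 1 0 + d • S2.ofCoords 0 0 0 1 := by
  simp [S2.smul_ofCoords, S2.ofCoords_add]

theorem S2.map_ofCoords {φ : S2 F →ₗ[F] S2 F} {a1 a2 a3 a4 b1 b2 b3 b4 c1 c2 c3 c4 d1 d2 d3 d4 : F}
    (hA : φ (S2.ofCoords 1 0 0 0) = S2.ofCoords a1 a2 a3 a4)
    (hB : φ (S2.ofCoords 0 1 0 0) = S2.ofCoords b1 b2 b3 b4)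
    (hC : φ (S2.ofCoords 0 0 1 0) = S2.ofCoords c1 c2 c3 c4)
    (hD : φ (S2.ofCoords 0 0 0 1) = S2.ofCoords d1 d2 d3 d4) (p q r s : F) :
    φ (S2.ofCoords p q r s) = S2.ofCoords (p * a1 + q * b1 + r * c1 + s * d1)
      (p * a2 + q * b2 + r * c2 + s * d2) (p * a3 + q * b3 + r * c3 + s * d3)
      (p * a4 + q * b4 + r * c4 + s * d4) := by
  rw [S2.ofCoords_eq_sum p q r s]
  simp only [map_add, map_smul, hA, hB, hC, hD]
  simp only [S2.smul_ofCoords, S2.ofCoords_add]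

theorem S2mul_ofCoords (a b c d a' b' c' d' : F) :
    S2mul (S2.ofCoords a b c d) (S2.ofCoords a' b' c' d') =
      S2.ofCoords (-a * a' + 2 * b * c' - c * b') (3 * b * a' - 3 * a * b')
        (a * c' + b * d' - 2 * c * a') (3 * a * d' - 3 * c * c') := by
  apply Subtype.ext
  simp only [S2mul, S2.coe_ofCoords, wmul_add_left, wmul_add_right, wmul_smul_left,
    wmul_smul_right, mul_e1_e1, mul_e1_e2, mul_e1_e3, mul_e1_e4, mul_e2_e1, mul_e2_e2, mul_e2_e3,
    mul_e2_e4, mul_e3_e1, mul_e3_e2, mul_e3_e3, mul_e3_e4, mul_e4_left]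
  module

/-- Every automorphism of `S2` belongs to an explicit two-parameter family. -/
theorem IsAutomorphismS2.exists_formula [CharZero F] {φ : S2 F →ₗ[F] S2 F}
    (hφ : IsAutomorphismS2 φ) : ∃ s t : F, t ≠ 0 ∧
      φ (S2.ofCoords 1 0 0 0) = S2.ofCoords 1 0 (2 * s) (3 * s ^ 2) ∧
      φ (S2.ofCoords 0 1 0 0) = S2.ofCoords (t * s) t (t * s ^ 2) (t * s ^ 3) ∧
      φ (S2.ofCoords 0 0 1 0) = S2.ofCoords 0 0 t⁻¹ (3 * s * t⁻¹) ∧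
      φ (S2.ofCoords 0 0 0 1) = S2.ofCoords 0 0 0 (t⁻¹ ^ 2) := by
  obtain ⟨⟨hinj, hsurj⟩, hmul⟩ := hφ
  obtain ⟨a1, a2, a3, a4, hA⟩ := S2.exists_eq_ofCoords (φ (S2.ofCoords 1 0 0 0))
  obtain ⟨b1, b2, b3, b4, hB⟩ := S2.exists_eq_ofCoords (φ (S2.ofCoords 0 1 0 0))
  obtain ⟨c1, c2, c3, c4, hC⟩ := S2.exists_eq_ofCoords (φ (S2.ofCoords 0 0 1 0))
  obtain ⟨d1, d2, d3, d4, hD⟩ := S2.exists_eq_ofCoords (φ (S2.ofCoords 0 0 0 1))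
  have h4 : d1 = 0 ∧ d2 = 0 ∧ d3 = 0 := by
    obtain ⟨x, hx⟩ := hsurj (S2.ofCoords 1 0 0 0)
    obtain ⟨p, q, r, s, rfl⟩ := S2.exists_eq_ofCoords x
    have h := hmul (S2.ofCoords 0 0 0 1) (S2.ofCoords p q r s)
    rw [hx, hD, S2mul_ofCoords, S2mul_ofCoords, S2.map_ofCoords hA hB hC hD, S2.ofCoords_inj] at h
    obtain ⟨h1, h2, h3, -⟩ := h
    refine ⟨by linear_combination h1, ?_, ?_⟩
    · have : (3 : F) * d2 = 0 := by linear_combination -h2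
      simpa using this
    · have : (2 : F) * d3 = 0 := by linear_combination h3
      simpa using this
  obtain ⟨rfl, rfl, rfl⟩ := h4
  have hd : d4 ≠ 0 := by
    rintro rfl
    have := hinj (hD.trans (show S2.ofCoords 0 0 0 0 = φ (S2.ofCoords 0 0 0 0) by
      rw [S2.ofCoords_eq_sum 0 0 0 0]
      simp))
    simp [S2.ofCoords_inj] at this
  have key (p q r s p' q' r' s' : F) := hmul (S2.ofCoords p q r s) (S2.ofCoords p' q' r' s')
  simp only [S2mul_ofCoords, S2.map_ofCoords hA hB hC hD, S2.ofCoords_inj] at key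
  have eAD := key 1 0 0 0 0 0 0 1
  have eCD := key 0 0 1 0 0 0 0 1
  have eCC := key 0 0 1 0 0 0 1 0
  have eAA := key 1 0 0 0 1 0 0 0
  have eBD := key 0 1 0 0 0 0 0 1
  have eAB := key 1 0 0 0 0 1 0 0
  clear key
  have ha2 : a2 = 0 := mul_right_cancel₀ hd (by linear_combination -eAD.2.2.1)
  have ha1 : a1 = 1 :=
    mul_right_cancel₀ (mul_ne_zero three_ne_zero hd) (by linear_combination -eAD.2.2.2)
  have hc2 : c2 = 0 := mul_right_cancel₀ hd (by linear_combination -eCD.2.2.1)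
  have hc1 : c1 = 0 :=
    mul_right_cancel₀ (mul_ne_zero three_ne_zero hd) (by linear_combination -eCD.2.2.2)
  subst ha1 ha2 hc1 hc2
  have h3 : (3 : F) ≠ 0 := three_ne_zero
  have hdc : d4 = c3 ^ 2 := mul_left_cancel₀ h3 (by linear_combination -eCC.2.2.2)
  subst hdc
  have hc3 : c3 ≠ 0 := by simpa using hd
  have hcb : c3 * b2 = 1 := mul_left_cancel₀ hc3 (by linear_combination -eBD.2.2.1)
  have hb2 : b2 ≠ 0 := right_ne_zero_of_mul_eq_one hcb
  obtain rfl : c3 = b2⁻¹ := eq_inv_of_mul_eq_one_left hcb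
  obtain ⟨s, rfl⟩ : ∃ s, b1 = b2 * s := ⟨b2⁻¹ * b1, by field_simp⟩
  have hc4 : c4 = 3 * s * b2⁻¹ := by
    linear_combination eBD.2.2.2 + 3 * s * b2⁻¹ * hcb
  have ha3 : a3 = 2 * s := mul_right_cancel₀ hb2 (by linear_combination eAB.1)
  subst hc4 ha3
  have h4 : (4 : F) ≠ 0 := by norm_num
  have h6 : (6 : F) ≠ 0 := by norm_num
  have ha4 : a4 = 3 * s ^ 2 := mul_left_cancel₀ h4 (by linear_combination -eAA.2.2.2)
  have hb3 : b3 = b2 * s ^ 2 := mul_left_cancel₀ h4 (by linear_combination -eAB.2.2.1)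
  subst hb3
  have hb4 : b4 = b2 * s ^ 3 := mul_left_cancel₀ h6 (by linear_combination -eAB.2.2.2)
  subst ha4 hb4
  exact ⟨s, b2, hb2, hA, hB, hC, hD⟩

/-- A linear map is determined by its values on the basis of `S2`. -/
theorem S2.linearMap_ext {φ ψ : S2 F →ₗ[F] S2 F}
    (h1 : φ (S2.ofCoords 1 0 0 0) = ψ (S2.ofCoords 1 0 0 0))
    (h2 : φ (S2.ofCoords 0 1 0 0) = ψ (S2.ofCoords 0 1 0 0))
    (h3 : φ (S2.ofCoords 0 0 1 0) = ψ (S2.ofCoords 0 0 1 0))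
    (h4 : φ (S2.ofCoords 0 0 0 1) = ψ (S2.ofCoords 0 0 0 1)) : φ = ψ := by
  ext1 x
  obtain ⟨a, b, c, d, rfl⟩ := S2.exists_eq_ofCoords x
  rw [S2.ofCoords_eq_sum]
  simp only [map_add, map_smul, h1, h2, h3, h4]

/-- An automorphism of `S2` is determined by the first two coordinates of its value at `e2`. -/
theorem IsAutomorphismS2.eq_of_coords [CharZero F] {φ ψ : S2 F →ₗ[F] S2 F}
    (hφ : IsAutomorphismS2 φ) (hψ : IsAutomorphismS2 ψ) {a b c d c' d' : F}
    (h : φ (S2.ofCoords 0 1 0 0) = S2.ofCoords a b c d)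
    (h' : ψ (S2.ofCoords 0 1 0 0) = S2.ofCoords a b c' d') : φ = ψ := by
  obtain ⟨s, t, ht, h1, h2, h3, h4⟩ := hφ.exists_formula
  obtain ⟨s', t', ht', h1', h2', h3', h4'⟩ := hψ.exists_formula
  obtain ⟨rfl, rfl, -, -⟩ := S2.ofCoords_inj.1 (h.symm.trans h2)
  obtain ⟨hs, rfl, -, -⟩ := S2.ofCoords_inj.1 (h'.symm.trans h2')
  obtain rfl := mul_left_cancel₀ ht hs
  exact S2.linearMap_ext (h1.trans h1'.symm) (h2.trans h2'.symm) (h3.trans h3'.symm)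
    (h4.trans h4'.symm)

/-- If `y` is a vector on which all automorphisms share the first two coordinates, then a local
automorphism which agrees with an automorphism at `e2` also agrees with it at `y`. -/
theorem localAutomorphism_apply_eq [CharZero F] {T φ : S2 F →ₗ[F] S2 F}
    (hT : ∀ x : S2 F, ∃ φ : S2 F →ₗ[F] S2 F, IsAutomorphismS2 φ ∧ T x = φ x)
    (hφ : IsAutomorphismS2 φ) (h2 : T (S2.ofCoords 0 1 0 0) = φ (S2.ofCoords 0 1 0 0))
    {y : S2 F} {a b : F}
    (hy : ∀ ψ : S2 F →ₗ[F] S2 F, IsAutomorphismS2 ψ → ∃ c d, ψ y = S2.ofCoords a b c d) :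
    T y = φ y := by
  obtain ⟨χ, hχ, hTy⟩ := hT y
  obtain ⟨ψ, hψ, hsum⟩ := hT (S2.ofCoords 0 1 0 0 + y)
  obtain ⟨c, d, hχy⟩ := hy χ hχ
  obtain ⟨c', d', hψy⟩ := hy ψ hψ
  obtain ⟨p, q, r, u, hp⟩ := S2.exists_eq_ofCoords (φ (S2.ofCoords 0 1 0 0))
  obtain ⟨p', q', r', u', hp'⟩ := S2.exists_eq_ofCoords (ψ (S2.ofCoords 0 1 0 0))
  have h := hsum
  rw [map_add, map_add, h2, hTy, hχy, hψy, hp, hp', S2.ofCoords_add, S2.ofCoords_add,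
    S2.ofCoords_inj] at h
  obtain ⟨hpp, hqq, -, -⟩ := h
  obtain rfl := add_right_cancel hpp
  obtain rfl := add_right_cancel hqq
  obtain rfl := hφ.eq_of_coords hψ hp hp'
  rw [map_add, map_add, h2] at hsum
  exact add_left_cancel hsum

/-- Every local automorphism of the algebra `S2` is an automorphism. -/
theorem every_localAutomorphism_isAutomorphism_S2 {F : Type*} [Field F] [CharZero F]
    (T : S2 F →ₗ[F] S2 F)
    (hT : ∀ x : S2 F, ∃ φ : S2 F →ₗ[F] S2 F, IsAutomorphismS2 φ ∧ T x = φ x) :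
    IsAutomorphismS2 T := by
  obtain ⟨φ, hφ, h2⟩ := hT (S2.ofCoords 0 1 0 0)
  suffices T = φ from this ▸ hφ
  refine S2.linearMap_ext (localAutomorphism_apply_eq hT hφ h2 (a := 1) (b := 0) fun ψ hψ => ?_) h2
    (localAutomorphism_apply_eq hT hφ h2 (a := 0) (b := 0) fun ψ hψ => ?_)
    (localAutomorphism_apply_eq hT hφ h2 (a := 0) (b := 0) fun ψ hψ => ?_) <;>
    obtain ⟨s, t, -, h1, -, h3, h4⟩ := hψ.exists_formula
  · exact ⟨_, _, h1⟩
  · exact ⟨_, _, h3⟩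
  · exact ⟨_, _, h4⟩
end
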